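/- For every n ≥ 2 and all P, Q ∈ Γ_n, one has (1/16)·Ψ(P‖Q) − I(P‖Q) ≤ (10/9)·[(1/16)·Ψ(P‖Q) − h(P‖Q)]. -/

import Mathlib

open Real BigOperators

noncomputable def triangularD {n : ℕ} (p q : Fin n → ℝ) : ℝ :=
  ∑ i, (p i - q i) ^ 2 / (p i + q i)

noncomputable def hellingerD {n : ℕ} (p q : Fin n → ℝ) : ℝ :=
  (1 / 2) * ∑ i, (Real.sqrt (p i) - Real.sqrt (q i)) ^ 2

noncomputable def symChiSqD {n : ℕ} (p q : Fin n → ℝ) : ℝ :=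
  ∑ i, (p i - q i) ^ 2 * (p i + q i) / (p i * q i)

noncomputable def jDiv {n : ℕ} (p q : Fin n → ℝ) : ℝ :=
  ∑ i, (p i - q i) * Real.log (p i / q i)

noncomputable def jsDiv {n : ℕ} (p q : Fin n → ℝ) : ℝ :=
  (1 / 2) * ((∑ i, p i * Real.log (2 * p i / (p i + q i))) +
    (∑ i, q i * Real.log (2 * q i / (p i + q i))))

noncomputable def agDiv {n : ℕ} (p q : Fin n → ℝ) : ℝ :=
  ∑ i, ((p i + q i) / 2) * Real.log ((p i + q i) / (2 * Real.sqrt (p i * q i)))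

noncomputable def dStar {n : ℕ} (p q : Fin n → ℝ) : ℝ :=
  ∑ i, (p i - q i) ^ 4 / Real.sqrt ((p i * q i) ^ 3)

lemma aux_log (t : ℝ) (ht : |t| < 1) :
    t^2 + t^4/6 + t^6/15 ≤ (1+t) * Real.log (1+t) + (1-t) * Real.log (1-t) := by
  obtain ⟨h1, h2⟩ := abs_lt.mp ht
  have hA := (Real.hasSum_log_sub_log_of_abs_lt_one ht).mul_left t
  have hy : |t^2| < 1 := by
    rw [abs_pow]; exact pow_lt_one₀ (abs_nonneg t) ht (by norm_num)
  have hB := Real.hasSum_pow_div_log_of_abs_lt_one hy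
  have hC := hA.sub hB
  have hl : Real.log (1 - t^2) = Real.log (1+t) + Real.log (1-t) := by
    rw [← Real.log_mul (by linarith) (by linarith)]; congr 1; ring
  have hD := sum_le_hasSum (Finset.range 3) (fun k _ => by
    have e : t * (2 * (1 / (2 * (k:ℝ) + 1)) * t ^ (2 * k + 1)) - (t ^ 2) ^ (k + 1) / ((k:ℝ) + 1)
        = (t^2)^(k+1) * (1 / ((2 * (k:ℝ) + 1) * ((k:ℝ)+1))) := by
      have : (2 * (k:ℝ) + 1) ≠ 0 := by positivity
      have : ((k:ℝ) + 1) ≠ 0 := by positivity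
      have e2 : (t^2)^(k+1) = t * t^(2*k+1) := by rw [← pow_mul]; ring
      rw [e2]
      field_simp
      ring
    rw [e]; positivity) hC
  rw [hl] at hD
  simp only [Finset.sum_range_succ, Finset.sum_range_zero] at hD
  norm_num at hD
  nlinarith [hD]

lemma aux_poly (s : ℝ) (h0 : 0 < s) (h1 : s ≤ 1) :
    10/9 * (1 - s) ≤ (1-s^2)/2 + (1-s^2)^2/12 + (1-s^2)^3/30 + (1-s^2)/(18*s^2) := by
  have key : (1-s^2)/2 + (1-s^2)^2/12 + (1-s^2)^3/30 + (1-s^2)/(18*s^2) - 10/9 * (1 - s)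
      = (1-s)^3 * (6*s^5+18*s^4+3*s^3+(-39*s^2+30*s+10)) / (180*s^2) := by
    field_simp
    ring
  have : 0 ≤ -39*s^2+30*s+10 := by nlinarith
  have h2 : 0 ≤ 1 - s := by linarith
  have : 0 ≤ (1-s)^3 * (6*s^5+18*s^4+3*s^3+(-39*s^2+30*s+10)) / (180*s^2) := by positivity
  linarith

lemma aux_term (p q : ℝ) (hp : 0 < p) (hq : 0 < q) :
    10/9 * ((1/2) * (Real.sqrt p - Real.sqrt q)^2) ≤
      (1/2) * (p * Real.log (2*p/(p+q)) + q * Real.log (2*q/(p+q)))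
      + (1/144) * ((p-q)^2*(p+q)/(p*q)) := by
  obtain ⟨m, hm⟩ : ∃ m, m = (p+q)/2 := ⟨_, rfl⟩
  obtain ⟨t, ht⟩ : ∃ t, t = (p-q)/(p+q) := ⟨_, rfl⟩
  have hm0 : 0 < m := by rw [hm]; positivity
  have ht1 : |t| < 1 := by
    rw [ht, abs_lt]
    constructor
    · rw [lt_div_iff₀ (by positivity)]; linarith
    · rw [div_lt_iff₀ (by positivity)]; linarith
  have e1 : 2*p/(p+q) = 1+t := by rw [ht]; field_simp; ring
  have e2 : 2*q/(p+q) = 1-t := by rw [ht]; field_simp; ring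
  have ep : p = m*(1+t) := by rw [ht, hm]; field_simp; ring
  have eq : q = m*(1-t) := by rw [ht, hm]; field_simp; ring
  obtain ⟨s, hs⟩ : ∃ s, s = Real.sqrt p * Real.sqrt q / m := ⟨_, rfl⟩
  have sp := Real.sq_sqrt hp.le
  have sq := Real.sq_sqrt hq.le
  have sp0 := Real.sqrt_pos.mpr hp
  have sq0 := Real.sqrt_pos.mpr hq
  have hs0 : 0 < s := by rw [hs]; positivity
  have hs2 : s^2 = 1 - t^2 := by
    rw [hs, div_pow, mul_pow, sp, sq, div_eq_iff (by positivity)]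
    rw [ep, eq]; ring
  have hs1 : s ≤ 1 := by nlinarith [sq_nonneg t]
  have hsm : Real.sqrt p * Real.sqrt q = m * s := by rw [hs]; field_simp
  have hh : (Real.sqrt p - Real.sqrt q)^2 = 2*m*(1-s) := by
    have : (Real.sqrt p - Real.sqrt q)^2 = p + q - 2*(Real.sqrt p * Real.sqrt q) := by
      rw [sub_sq, sp, sq]; ring
    rw [this, hsm]; linarith
  have hpsi : (p-q)^2*(p+q)/(p*q) = m * (8*(1-s^2)/s^2) := by
    have a : p*q = m^2*s^2 := by rw [hs2, ep, eq]; ring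
    have b : p - q = 2*m*t := by rw [ep, eq]; ring
    have c : p + q = 2*m := by linarith
    have d : 1 - s^2 = t^2 := by linarith
    rw [a, b, c, d]; field_simp; ring
  have L := aux_log t ht1
  have P := aux_poly s hs0 hs1
  have d : 1 - s^2 = t^2 := by linarith
  rw [hh, hpsi, e1, e2, d]
  rw [d] at P
  have f : p * Real.log (1+t) + q * Real.log (1-t)
    = m * ((1+t) * Real.log (1+t) + (1-t) * Real.log (1-t)) := by
    conv_lhs => rw [ep, eq]
    ring
  rw [f]
  have g : 8*t^2/s^2 = 144 * (t^2/(18*s^2)) := by field_simp; ring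
  rw [g]
  have := mul_le_mul_of_nonneg_left L hm0.le
  have := mul_le_mul_of_nonneg_left P hm0.le
  nlinarith

theorem stmt_16 (n : ℕ) (hn : 2 ≤ n) (p q : Fin n → ℝ)
    (hp : ∀ i, 0 < p i) (hq : ∀ i, 0 < q i)
    (hps : ∑ i, p i = 1) (hqs : ∑ i, q i = 1) :
    (1 / 16) * symChiSqD p q - jsDiv p q ≤ (10 / 9) * ((1 / 16) * symChiSqD p q - hellingerD p q) := by
  have H := Finset.sum_le_sum (fun i (_ : i ∈ Finset.univ) => aux_term (p i) (q i) (hp i) (hq i))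
  rw [Finset.sum_add_distrib] at H
  simp only [← Finset.mul_sum] at H
  rw [Finset.sum_add_distrib] at H
  unfold symChiSqD jsDiv hellingerD
  linarith
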